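/- arXiv:2303.11524 — 3 statements merged into one kernel-verified Lean document; each statement's English description precedes it below -/
import Mathlib

section
/- Let d ≥ 1, κ_1,…,κ_d > 0, λ_κ = Σ_{j=1}^d κ_j, and T ∈ (0,∞]. Let u be a positive C^{1,2} function on [0,T) × ℝ^d satisfying ∂_t u(t,x) = Δ_κ u(t,·)(x) − |x|² u(t,x) at every (t,x) with t ∈ (0,T) and x_j ≠ 0 for all j, and assume u is represented by the heat kernel of the Dunkl harmonic oscillator: u(t,x) = ∫_{ℝ^d} u(0,y) h_t(x,y) ∏_{j=1}^d |y_j|^{2κ_j} dy and ∂_t u(t,x) = ∫_{ℝ^d} u(0,y) ∂_t h_t(x,y) ∏_{j=1}^d |y_j|^{2κ_j} dy for all (t,x) ∈ (0,T) × ℝ^d, with differentiation in x allowed under the integral sign. Then −Δ_κ(log u(t,·))(x) ≤ (d + 2λ_κ) coth(2t) ≤ (d + 2λ_κ)(1 + 1/(2t)) for every t ∈ (0,T) and every x with x_j ≠ 0 for all j. -/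
open Real MeasureTheory

/-- Partial derivative `∂f/∂x_j` at `x`. -/
noncomputable def pd {d : ℕ} (f : (Fin d → ℝ) → ℝ) (j : Fin d) (x : Fin d → ℝ) : ℝ :=
  deriv (fun s => f (Function.update x j s)) (x j)

/-- The `ℤ₂^d` Dunkl Laplacian
`Δ_κ f(x) = Σ_j [ ∂²_j f(x) + (κ_j/x_j²)(2 x_j ∂_j f(x) − f(x) + f(σ_j x)) ]`. -/
noncomputable def dunklLapZ2 {d : ℕ} (κ : Fin d → ℝ) (f : (Fin d → ℝ) → ℝ)
    (x : Fin d → ℝ) : ℝ :=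
  ∑ j, (pd (fun z => pd f j z) j x
    + κ j / (x j) ^ 2 * (2 * x j * pd f j x - f x + f (Function.update x j (-(x j)))))

/-- The one-dimensional kernel `h_t^{(κ)}(u,v)`. -/
noncomputable def hKer (κ t u v : ℝ) : ℝ :=
  ((2 : ℝ) ^ (κ + 1/2) * Real.sqrt π * Real.Gamma (κ + 1/2))⁻¹
    * Real.sinh (2*t) ^ (-(κ + 1/2))
    * Real.exp (-(1/2) * (Real.cosh (2*t) / Real.sinh (2*t)) * (u^2 + v^2))
    * ∫ s in (-1 : ℝ)..(1 : ℝ),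
        (1 - s) ^ (κ - 1) * (1 + s) ^ κ * Real.exp (u * v * s / Real.sinh (2*t))

/-- The heat kernel of the Dunkl harmonic oscillator in the `ℤ₂^d` case. -/
noncomputable def hHeat {d : ℕ} (κ : Fin d → ℝ) (t : ℝ) (x y : Fin d → ℝ) : ℝ :=
  ∏ j, hKer (κ j) t (x j) (y j)

theorem convexOn_integral_of_ae {α : Type*} [MeasurableSpace α] {μ : Measure α}
    {f : ℝ → α → ℝ} (hf : ∀ᵐ a ∂μ, ConvexOn ℝ Set.univ fun z => f z a)
    (hi : ∀ z, Integrable (f z) μ) :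
    ConvexOn ℝ Set.univ fun z => ∫ a, f z a ∂μ := by
  refine ⟨convex_univ, fun x _ y _ p q hp hq hpq => ?_⟩
  have hx := (hi x).const_mul p
  have hy := (hi y).const_mul q
  simp only [smul_eq_mul]
  rw [← integral_const_mul, ← integral_const_mul, ← integral_add hx hy]
  refine integral_mono_ae (hi _) (hx.add hy) ?_
  filter_upwards [hf] with a ha
  simpa using ha.2 (Set.mem_univ x) (Set.mem_univ y) hp hq hpq

/-- A positive function is log-convex as soon as all its exponential tilts are convex. -/
theorem convexOn_log_of_forall_convexOn_exp_mul {g : ℝ → ℝ} (hg : ∀ z, 0 < g z)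
    (h : ∀ c : ℝ, ConvexOn ℝ Set.univ fun z => Real.exp (c * z) * g z) :
    ConvexOn ℝ Set.univ fun z => Real.log (g z) := by
  refine ⟨convex_univ, fun x _ y _ p q hp hq hpq => ?_⟩
  rcases eq_or_ne x y with rfl | hxy
  · rw [← add_smul, ← add_smul, hpq, one_smul, one_smul]
  have hxy' : y - x ≠ 0 := sub_ne_zero.mpr hxy.symm
  set c := (Real.log (g x) - Real.log (g y)) / (y - x) with hc
  have hcd : c * y + Real.log (g y) = c * x + Real.log (g x) := by
    rw [hc]; field_simp; ring
  have key := (h c).2 (Set.mem_univ x) (Set.mem_univ y) hp hq hpq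
  have hexp : ∀ z, Real.exp (c * z) * g z = Real.exp (c * z + Real.log (g z)) := fun z => by
    rw [Real.exp_add, Real.exp_log (hg z)]
  simp only [hexp, hcd, ← add_smul, hpq, one_smul, Real.exp_le_exp] at key
  simp only [smul_eq_mul] at key ⊢
  linear_combination key - q * hcd - (c * x + Real.log (g x)) * hpq

theorem intervalIntegrable_one_sub_rpow_mul_one_add_rpow {κ : ℝ} (hκ : 0 < κ) :
    IntervalIntegrable (fun s : ℝ => (1 - s) ^ (κ - 1) * (1 + s) ^ κ) volume (-1) 1 := by
  refine IntervalIntegrable.mul_continuousOn ?_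
    (((continuous_const.add continuous_id).rpow_const fun _ => Or.inr hκ.le).continuousOn)
  have h := (intervalIntegral.intervalIntegrable_rpow' (a := 2) (b := 0)
    (r := κ - 1) (by linarith)).comp_sub_left 1
  norm_num at h
  exact h

theorem convexOn_exp_affine (a b : ℝ) :
    ConvexOn ℝ Set.univ fun z : ℝ => Real.exp (a * z + b) := by
  refine ⟨convex_univ, fun x _ y _ p q hp hq hpq => ?_⟩
  have := convexOn_exp.2 (Set.mem_univ (a * x + b)) (Set.mem_univ (a * y + b)) hp hq hpq
  simp only [smul_eq_mul] at this ⊢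
  convert this using 2
  linear_combination -b * hpq

/-- The Dunkl-type exponential integral is convex after any exponential tilt. -/
theorem convexOn_exp_mul_integral {κ : ℝ} (hκ : 0 < κ) (c b : ℝ) :
    ConvexOn ℝ Set.univ fun z : ℝ => Real.exp (c * z) *
      ∫ s in (-1 : ℝ)..1, (1 - s) ^ (κ - 1) * (1 + s) ^ κ * Real.exp (z * b * s) := by
  have hle : (-1 : ℝ) ≤ 1 := by norm_num
  simp only [intervalIntegral.integral_of_le hle, ← integral_const_mul]
  apply convexOn_integral_of_ae
  · filter_upwards [ae_restrict_mem measurableSet_Ioc] with s hs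
    have hw : 0 ≤ (1 - s) ^ (κ - 1) * (1 + s) ^ κ :=
      mul_nonneg (rpow_nonneg (by linarith [hs.2]) _) (rpow_nonneg (by linarith [hs.1]) _)
    refine ((convexOn_exp_affine (c + b * s) 0).smul hw).congr fun z _ => ?_
    have : (c + b * s) * z + 0 = c * z + z * b * s := by ring
    simp only [smul_eq_mul, this, Real.exp_add]
    ring
  · intro z
    rw [← IntegrableOn, ← intervalIntegrable_iff_integrableOn_Ioc_of_le hle]
    exact ((intervalIntegrable_one_sub_rpow_mul_one_add_rpow hκ).mul_continuousOn
      (by fun_prop)).const_mul _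

theorem hKer_nonneg {κ t : ℝ} (hκ : 0 < κ) (ht : 0 < t) (u v : ℝ) : 0 ≤ hKer κ t u v := by
  have hG := Real.Gamma_pos_of_pos (show 0 < κ + 1 / 2 by linarith)
  have hS : 0 < Real.sinh (2 * t) := Real.sinh_pos_iff.mpr (by linarith)
  refine mul_nonneg (by positivity)
    (intervalIntegral.integral_nonneg (by norm_num) fun s hs => ?_)
  exact mul_nonneg (mul_nonneg (rpow_nonneg (by linarith [hs.2]) _)
    (rpow_nonneg (by linarith [hs.1]) _)) (Real.exp_pos _).le

theorem convexOn_exp_mul_hKer {κ t : ℝ} (hκ : 0 < κ) (ht : 0 < t) (c v : ℝ) :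
    ConvexOn ℝ Set.univ fun z => Real.exp (c * z) *
      (Real.exp (Real.cosh (2 * t) / Real.sinh (2 * t) * z ^ 2 / 2) * hKer κ t z v) := by
  have hG := Real.Gamma_pos_of_pos (show 0 < κ + 1 / 2 by linarith)
  have hS : 0 < Real.sinh (2 * t) := Real.sinh_pos_iff.mpr (by linarith)
  set a := Real.cosh (2 * t) / Real.sinh (2 * t) with ha
  have hK : 0 ≤ ((2 : ℝ) ^ (κ + 1/2) * Real.sqrt π * Real.Gamma (κ + 1/2))⁻¹
      * Real.sinh (2 * t) ^ (-(κ + 1/2)) * Real.exp (-(1/2) * a * v ^ 2) := by positivity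
  refine ((convexOn_exp_mul_integral hκ c (v / Real.sinh (2 * t))).smul hK).congr
    fun z _ => ?_
  have hs : ∀ s, z * (v / Real.sinh (2 * t)) * s = z * v * s / Real.sinh (2 * t) :=
    fun s => by ring
  have he : Real.exp (-(1/2) * a * (z ^ 2 + v ^ 2))
      = Real.exp (-(a * z ^ 2 / 2)) * Real.exp (-(1/2) * a * v ^ 2) := by
    rw [← Real.exp_add]; congr 1; ring
  have hone : Real.exp (a * z ^ 2 / 2) * Real.exp (-(a * z ^ 2 / 2)) = 1 := by
    rw [← Real.exp_add]; simp
  simp only [smul_eq_mul, hs, hKer, ← ha, he]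
  generalize (∫ s in (-1 : ℝ)..1, (1 - s) ^ (κ - 1) * (1 + s) ^ κ *
    Real.exp (z * v * s / Real.sinh (2 * t))) = I
  generalize ((2 : ℝ) ^ (κ + 1/2) * Real.sqrt π * Real.Gamma (κ + 1/2))⁻¹ = A
  generalize Real.sinh (2 * t) ^ (-(κ + 1/2)) = B
  linear_combination (-(A * B * Real.exp (-(1/2) * a * v ^ 2) * Real.exp (c * z) * I)) * hone

theorem hHeat_update {d : ℕ} (κ : Fin d → ℝ) (t : ℝ) (x y : Fin d → ℝ) (j : Fin d) (z : ℝ) :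
    hHeat κ t (Function.update x j z) y
      = hKer (κ j) t z (y j) * ∏ i ∈ Finset.univ.erase j, hKer (κ i) t (x i) (y i) := by
  rw [hHeat, ← Finset.mul_prod_erase _ _ (Finset.mem_univ j), Function.update_self]
  congr 1
  refine Finset.prod_congr rfl fun i hi => ?_
  rw [Function.update_of_ne (Finset.ne_of_mem_erase hi)]

/-- Integrals against the heat kernel are log-convex in each coordinate after removing the
Gaussian factor. -/
theorem convexOn_log_add_of_heat_representation {d : ℕ} {κ : Fin d → ℝ} (hκ : ∀ j, 0 < κ j)
    {t : ℝ} (ht : 0 < t) {f w : (Fin d → ℝ) → ℝ} (hf : ∀ y, 0 ≤ f y) (hw : ∀ x, 0 < w x)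
    (hint : ∀ x, Integrable (fun y => f y * hHeat κ t x y * ∏ j, |y j| ^ (2 * κ j)) volume)
    (hrep : ∀ x, w x = ∫ y, f y * hHeat κ t x y * ∏ j, |y j| ^ (2 * κ j))
    (x : Fin d → ℝ) (j : Fin d) :
    ConvexOn ℝ Set.univ fun z => Real.log (w (Function.update x j z))
      + Real.cosh (2 * t) / Real.sinh (2 * t) * z ^ 2 / 2 := by
  set a := Real.cosh (2 * t) / Real.sinh (2 * t) with ha
  refine (convexOn_log_of_forall_convexOn_exp_mul
    (g := fun z => Real.exp (a * z ^ 2 / 2) * w (Function.update x j z))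
    (fun z => mul_pos (Real.exp_pos _) (hw _)) fun c => ?_).congr fun z _ => ?_
  · simp only [hrep, ← integral_const_mul]
    refine convexOn_integral_of_ae (.of_forall fun y => ?_)
      fun z => ((hint _).const_mul _).const_mul _
    have hK : 0 ≤ f y * (∏ i ∈ Finset.univ.erase j, hKer (κ i) t (x i) (y i))
        * ∏ j, |y j| ^ (2 * κ j) :=
      mul_nonneg (mul_nonneg (hf y) (Finset.prod_nonneg fun i _ => hKer_nonneg (hκ i) ht _ _))
        (Finset.prod_nonneg fun i _ => rpow_nonneg (abs_nonneg _) _)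
    refine ((convexOn_exp_mul_hKer (hκ j) ht c (y j)).smul hK).congr fun z _ => ?_
    simp only [smul_eq_mul, hHeat_update, ← ha]
    ring
  · simp only [Real.log_mul (Real.exp_pos _).ne' (hw _).ne', Real.log_exp]
    ring

/-- One-dimensional Dunkl Laplacian bound from semiconvexity. -/
theorem neg_dunkl_le_of_convexOn {L : ℝ → ℝ} (hL : ContDiff ℝ 2 L) {a k : ℝ} (hk : 0 ≤ k)
    (hconv : ConvexOn ℝ Set.univ fun z => L z + a * z ^ 2 / 2) {z : ℝ} (hz : z ≠ 0) :
    -(deriv (deriv L) z + k / z ^ 2 * (2 * z * deriv L z - L z + L (-z)))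
      ≤ (1 + 2 * k) * a := by
  have hd : Differentiable ℝ L := hL.differentiable (by norm_num)
  have hd2 : Differentiable ℝ (deriv L) :=
    hL.differentiable_deriv_two
  have hq : ∀ y, HasDerivAt (fun z => L z + a * z ^ 2 / 2) (deriv L y + a * y) y := fun y => by
    refine ((hd y).hasDerivAt.add (((hasDerivAt_pow 2 y).const_mul a).div_const 2)).congr_deriv ?_
    norm_num
    ring
  have hderiv : deriv (fun z => L z + a * z ^ 2 / 2) = fun y => deriv L y + a * y :=
    funext fun y => (hq y).deriv
  have hmono : Monotone fun y => deriv L y + a * y := by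
    rw [← hderiv, ← monotoneOn_univ]
    exact hconv.monotoneOn_deriv fun y _ => (hq y).differentiableAt
  have h2 : 0 ≤ deriv (deriv L) z + a := by
    have h := ((hd2 z).hasDerivAt.add ((hasDerivAt_id z).const_mul a)).deriv
    have h0 := hmono.deriv_nonneg (x := z)
    simp only [mul_one] at h
    rw [← h]
    exact h0
  have htan : 0 ≤ 2 * z * deriv L z - L z + L (-z) + 2 * a * z ^ 2 := by
    rcases lt_or_gt_of_ne hz with hz | hz
    · have h := hconv.le_slope_of_hasDerivAt (Set.mem_univ z) (Set.mem_univ (-z))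
        (by linarith) (hq z)
      rw [slope_def_field, le_div_iff₀ (by linarith)] at h
      linarith
    · have h := hconv.slope_le_of_hasDerivAt (Set.mem_univ (-z)) (Set.mem_univ z)
        (by linarith) (hq z)
      rw [slope_def_field, div_le_iff₀ (by linarith)] at h
      linarith
  have h3 := mul_nonneg (div_nonneg hk (sq_nonneg z)) htan
  have h4 : k / z ^ 2 * (2 * a * z ^ 2) = 2 * k * a := by field_simp
  rw [mul_add, h4] at h3
  linarith

theorem cosh_div_sinh_le_one_add_one_div {s : ℝ} (hs : 0 < s) :
    Real.cosh s / Real.sinh s ≤ 1 + 1 / s := by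
  have hS : 0 < Real.sinh s := Real.sinh_pos_iff.mpr hs
  have h1 : s ≤ Real.sinh s := Real.self_le_sinh_iff.mpr hs.le
  have h2 : Real.cosh s - Real.sinh s ≤ 1 := by
    rw [Real.cosh_sub_sinh]; exact Real.exp_le_one_iff.mpr (by linarith)
  rw [show 1 + 1 / s = (s + 1) / s by field_simp, div_le_div_iff₀ hS hs]
  nlinarith

/-- **Li–Yau inequality for positive solutions of the heat equation of the Dunkl
harmonic oscillator** (`ℤ₂^d` case): if `u` is a positive `C^{1,2}` solution of
`∂_t u = Δ_κ u − |x|² u` represented by the heat kernel `h_t` (with differentiation in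
`x` allowed under the integral sign), then
`−Δ_κ(log u(t,·))(x) ≤ (d + 2λ_κ) coth(2t) ≤ (d + 2λ_κ)(1 + 1/(2t))`. -/
theorem stmt4 (d : ℕ) (hd : 1 ≤ d) (κ : Fin d → ℝ) (hκ : ∀ j, 0 < κ j)
    (lamκ : ℝ) (hlam : lamκ = ∑ j, κ j)
    (T : EReal) (hT : 0 < T)
    (u : ℝ → (Fin d → ℝ) → ℝ)
    (hupos : ∀ (t : ℝ) x, 0 ≤ t → (t : EReal) < T → 0 < u t x)
    (huC1 : ∀ x, ContDiffOn ℝ 1 (fun s => u s x) {s : ℝ | 0 < s ∧ (s : EReal) < T})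
    (huC2 : ∀ (t : ℝ), 0 < t → (t : EReal) < T → ContDiff ℝ 2 (fun z => u t z))
    -- `u` solves `∂_t u = Δ_κ u − |x|² u` at every regular point
    (hPDE : ∀ (t : ℝ) x, 0 < t → (t : EReal) < T → (∀ j, x j ≠ 0) →
      deriv (fun s => u s x) t
        = dunklLapZ2 κ (fun z => u t z) x - (∑ j, (x j) ^ 2) * u t x)
    -- representation of `u` and `∂_t u` by the heat kernel, with absolute convergence
    (hrepint : ∀ (t : ℝ) x, 0 < t → (t : EReal) < T →
      Integrable (fun y => u 0 y * hHeat κ t x y * ∏ j, |y j| ^ (2 * κ j)) volume)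
    (hrep : ∀ (t : ℝ) x, 0 < t → (t : EReal) < T →
      u t x = ∫ y, u 0 y * hHeat κ t x y * ∏ j, |y j| ^ (2 * κ j))
    (hreptint : ∀ (t : ℝ) x, 0 < t → (t : EReal) < T →
      Integrable
        (fun y => u 0 y * deriv (fun s => hHeat κ s x y) t * ∏ j, |y j| ^ (2 * κ j)) volume)
    (hrept : ∀ (t : ℝ) x, 0 < t → (t : EReal) < T →
      deriv (fun s => u s x) t
        = ∫ y, u 0 y * deriv (fun s => hHeat κ s x y) t * ∏ j, |y j| ^ (2 * κ j))
    -- first-order derivatives in `x` may be taken under the integral sign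
    (hgradint : ∀ (t : ℝ) x (j : Fin d), 0 < t → (t : EReal) < T →
      Integrable
        (fun y => u 0 y * pd (fun z => hHeat κ t z y) j x * ∏ i, |y i| ^ (2 * κ i)) volume)
    (hgrad : ∀ (t : ℝ) x (j : Fin d), 0 < t → (t : EReal) < T →
      pd (fun z => u t z) j x
        = ∫ y, u 0 y * pd (fun z => hHeat κ t z y) j x * ∏ i, |y i| ^ (2 * κ i))
    -- second-order derivatives in `x` may be taken under the integral sign
    (hlapint : ∀ (t : ℝ) x (j : Fin d), 0 < t → (t : EReal) < T →
      Integrable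
        (fun y => u 0 y * pd (fun z => pd (fun w => hHeat κ t w y) j z) j x
          * ∏ i, |y i| ^ (2 * κ i)) volume)
    (hlap : ∀ (t : ℝ) x (j : Fin d), 0 < t → (t : EReal) < T →
      pd (fun z => pd (fun w => u t w) j z) j x
        = ∫ y, u 0 y * pd (fun z => pd (fun w => hHeat κ t w y) j z) j x
            * ∏ i, |y i| ^ (2 * κ i)) :
    ∀ (t : ℝ) x, 0 < t → (t : EReal) < T → (∀ j, x j ≠ 0) →
      -dunklLapZ2 κ (fun z => Real.log (u t z)) x
          ≤ ((d : ℝ) + 2 * lamκ) * (Real.cosh (2*t) / Real.sinh (2*t))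
      ∧ ((d : ℝ) + 2 * lamκ) * (Real.cosh (2*t) / Real.sinh (2*t))
          ≤ ((d : ℝ) + 2 * lamκ) * (1 + 1/(2*t)) := by
  intro t x ht htT hx
  subst hlam
  set a := Real.cosh (2 * t) / Real.sinh (2 * t) with ha
  have hu := fun z => hupos t z ht.le htT
  refine ⟨?_, mul_le_mul_of_nonneg_left (cosh_div_sinh_le_one_add_one_div (by linarith)) ?_⟩
  · have hsum : ((d : ℝ) + 2 * ∑ j, κ j) * a = ∑ j, (1 + 2 * κ j) * a := by
      rw [← Finset.sum_mul, Finset.sum_add_distrib, ← Finset.mul_sum]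
      simp
    rw [hsum, dunklLapZ2, ← Finset.sum_neg_distrib]
    refine Finset.sum_le_sum fun j _ => ?_
    have hconv := convexOn_log_add_of_heat_representation hκ ht
      (fun y => (hupos 0 y le_rfl (by simpa using hT)).le) hu
      (fun z => hrepint t z ht htT) (fun z => hrep t z ht htT) x j
    have hL : ContDiff ℝ 2 fun z => Real.log (u t (Function.update x j z)) :=
      ((huC2 t ht htT).comp (contDiff_update 2 x j)).log fun z => (hu _).ne'
    have h := neg_dunkl_le_of_convexOn hL (hκ j).le hconv (hx j)
    simpa [pd, Function.update_idem, Function.update_eq_self] using h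
  · have : 0 ≤ ∑ j, κ j := Finset.sum_nonneg fun j _ => (hκ j).le
    positivity
end

section
/- Let T ∈ (0,∞] and let β : (0,T) × ℝ^d → ℝ be jointly continuous. Let u : (0,T) × ℝ^d → (0,∞) be C¹ in t and C¹ in x. If for every 0 < s < t < T and every x,y ∈ ℝ^d one has u(s,x) ≤ u(t,y) exp{ |x−y|²/(4(t−s)) + (t−s) ∫_0^1 β(t + τ(s−t), y + τ(x−y)) dτ }, then |∇u(t,·)(x)|²/u(t,x)² − ∂_t u(t,x)/u(t,x) ≤ β(t,x) for all (t,x) ∈ (0,T) × ℝ^d. -/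
open Real MeasureTheory

theorem HasDerivAt.nonneg_of_eventually_nonneg_right {G : ℝ → ℝ} {G' a : ℝ}
    (hG : HasDerivAt G G' a) (h0 : G a = 0) (hpos : ∀ᶠ h in nhdsWithin a (Set.Ioi a), 0 ≤ G h) :
    0 ≤ G' := by
  have hslope := (hasDerivWithinAt_iff_tendsto_slope' (Set.notMem_Ioi.2 le_rfl)).1
    (hG.hasDerivWithinAt (s := Set.Ioi a))
  refine ge_of_tendsto hslope ?_
  filter_upwards [hpos, self_mem_nhdsWithin] with h hh hlt
  rw [slope_def_field, h0, sub_zero]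
  exact div_nonneg hh (sub_nonneg.2 (le_of_lt hlt))

theorem pd_eq_fderiv {d : ℕ} {f : (Fin d → ℝ) → ℝ} {x : Fin d → ℝ}
    (hf : DifferentiableAt ℝ f x) (j : Fin d) : pd f j x = fderiv ℝ f x (Pi.single j 1) := by
  have hx : Function.update x j (x j) = x := Function.update_eq_self j x
  have hf' : HasFDerivAt f (fderiv ℝ f x) (Function.update x j (x j)) := by
    rw [hx]; exact hf.hasFDerivAt
  exact (hf'.comp_hasDerivAt (x j) (hasDerivAt_update x j (x j))).deriv

theorem fderiv_apply_eq_sum_pd {d : ℕ} {f : (Fin d → ℝ) → ℝ} {x : Fin d → ℝ}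
    (hf : DifferentiableAt ℝ f x) (w : Fin d → ℝ) :
    fderiv ℝ f x w = ∑ j, w j * pd f j x := by
  conv_lhs => rw [pi_eq_sum_univ' w]
  simp [pd_eq_fderiv hf]

/-- Averages of `β` over short segments ending at `(t, x)` are eventually below `β t x + ε`. -/
theorem eventually_integral_segment_le {E : Type*} [NormedAddCommGroup E] [NormedSpace ℝ E]
    {β : ℝ → E → ℝ} {S : Set (ℝ × E)} (hS : IsOpen S)
    (hβ : ContinuousOn (fun p : ℝ × E => β p.1 p.2) S) {t : ℝ} {x : E} (htx : (t, x) ∈ S) (w : E)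
    {ε : ℝ} (hε : 0 < ε) :
    ∀ᶠ h in nhdsWithin (0 : ℝ) (Set.Ioi 0),
      ∫ τ in (0 : ℝ)..(1 : ℝ), β (t + τ * ((t - h) - t)) ((x + h • w) + τ • (x - (x + h • w)))
        ≤ β t x + ε := by
  have hc := hβ.continuousAt (hS.mem_nhds htx)
  obtain ⟨δ, hδ, hball⟩ := Metric.eventually_nhds_iff.1
    (Filter.Eventually.and (hS.eventually_mem htx) (Metric.continuousAt_iff'.1 hc ε hε))
  have hη : 0 < δ / (1 + ‖w‖) := by positivity
  filter_upwards [Ioo_mem_nhdsGT hη] with h hh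
  have hh0 : 0 < h := hh.1
  have hhδ : h * (1 + ‖w‖) < δ := (lt_div_iff₀ (by positivity)).1 hh.2
  have hw := mul_nonneg hh0.le (norm_nonneg w)
  have hnear : ∀ τ ∈ Set.Icc (0 : ℝ) 1,
      dist ((t + τ * ((t - h) - t), (x + h • w) + τ • (x - (x + h • w))) : ℝ × E) (t, x) < δ := by
    intro τ hτ
    rw [Prod.dist_eq, max_lt_iff]
    constructor
    · rw [Real.dist_eq, show t + τ * ((t - h) - t) - t = -(τ * h) by ring, abs_neg,
        abs_of_nonneg (mul_nonneg hτ.1 hh0.le)]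
      nlinarith [hτ.2]
    · rw [dist_eq_norm, show (x + h • w) + τ • (x - (x + h • w)) - x = ((1 - τ) * h) • w by
          module, norm_smul, Real.norm_of_nonneg (mul_nonneg (sub_nonneg.2 hτ.2) hh0.le)]
      nlinarith [mul_nonneg hτ.1 hw]
  have hcont : ContinuousOn
      (fun τ : ℝ => β (t + τ * ((t - h) - t)) ((x + h • w) + τ • (x - (x + h • w))))
      (Set.Icc 0 1) :=
    hβ.comp (f := fun τ : ℝ => (t + τ * ((t - h) - t), (x + h • w) + τ • (x - (x + h • w))))
      (by fun_prop) fun τ hτ => (hball (hnear τ hτ)).1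
  calc
    _ ≤ ∫ _ in (0 : ℝ)..(1 : ℝ), (β t x + ε) := by
      refine intervalIntegral.integral_mono_on zero_le_one
        (hcont.intervalIntegrable_of_Icc zero_le_one) intervalIntegrable_const fun τ hτ => ?_
      have hlt := (hball (hnear τ hτ)).2
      rw [Real.dist_eq] at hlt
      linarith [(abs_lt.1 hlt).2]
    _ = β t x + ε := by simp

/-- The parabolic Harnack inequality
`u(s,x) ≤ u(t,y) exp{|x−y|²/(4(t−s)) + (t−s)∫₀¹ β(t+τ(s−t), y+τ(x−y)) dτ}`
implies the Li–Yau inequality `|∇u|²/u² − ∂_t u/u ≤ β`. -/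
theorem stmt7 (d : ℕ) (T : EReal) (hT : 0 < T)
    (β : ℝ → (Fin d → ℝ) → ℝ)
    (hβ : ContinuousOn (fun p : ℝ × (Fin d → ℝ) => β p.1 p.2)
      {p : ℝ × (Fin d → ℝ) | 0 < p.1 ∧ (p.1 : EReal) < T})
    (u : ℝ → (Fin d → ℝ) → ℝ)
    (hupos : ∀ (t : ℝ) x, 0 < t → (t : EReal) < T → 0 < u t x)
    (huC1t : ∀ x, ContDiffOn ℝ 1 (fun s => u s x) {s : ℝ | 0 < s ∧ (s : EReal) < T})
    (huC1x : ∀ (t : ℝ), 0 < t → (t : EReal) < T → ContDiff ℝ 1 (fun z => u t z))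
    (hHar : ∀ (s t : ℝ) (x y : Fin d → ℝ), 0 < s → s < t → (t : EReal) < T →
      u s x ≤ u t y * Real.exp ((∑ j, (x j - y j) ^ 2) / (4 * (t - s))
        + (t - s) * ∫ τ in (0 : ℝ)..(1 : ℝ), β (t + τ * (s - t)) (y + τ • (x - y)))) :
    ∀ (t : ℝ) x, 0 < t → (t : EReal) < T →
      (∑ j, (pd (fun z => u t z) j x) ^ 2) / (u t x) ^ 2
          - deriv (fun s => u s x) t / u t x ≤ β t x := by
  intro t x ht htT
  have hI : IsOpen {s : ℝ | 0 < s ∧ (s : EReal) < T} :=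
    isOpen_Ioi.inter (isOpen_lt continuous_coe_real_ereal continuous_const)
  have hS : IsOpen {p : ℝ × (Fin d → ℝ) | 0 < p.1 ∧ (p.1 : EReal) < T} :=
    hI.preimage continuous_fst
  have hux := hupos t x ht htT
  have hdx : DifferentiableAt ℝ (fun z => u t z) x :=
    (huC1x t ht htT).differentiable one_ne_zero x
  have hdt : DifferentiableAt ℝ (fun s => u s x) t :=
    ((huC1t x).differentiableOn one_ne_zero).differentiableAt (hI.mem_nhds ⟨ht, htT⟩)
  -- The optimal direction in the Harnack inequality.
  set w : Fin d → ℝ := fun j => -2 * pd (fun z => u t z) j x / u t x with hw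
  set D := fderiv ℝ (fun z => u t z) x w with hD
  have hspace : HasDerivAt (fun h : ℝ => Real.log (u t (x + h • w))) (D / u t x) 0 := by
    have hline : HasDerivAt (fun h : ℝ => x + h • w) w 0 := by
      simpa using ((hasDerivAt_id (0 : ℝ)).smul_const w).const_add x
    have hf : HasFDerivAt (fun z => u t z) (fderiv ℝ (fun z => u t z) x)
        (x + (0 : ℝ) • w) := by
      simpa using hdx.hasFDerivAt
    simpa using (hf.comp_hasDerivAt 0 hline).log (by simpa using hux.ne')
  have htime : HasDerivAt (fun h : ℝ => Real.log (u (t - h) x))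
      (-deriv (fun s => u s x) t / u t x) 0 := by
    have hf : HasDerivAt (fun s => u s x) (deriv (fun s => u s x) t) (t - 0) := by
      simpa using hdt.hasDerivAt
    simpa using (hf.comp_const_sub t 0).log (by simpa using hux.ne')
  refine le_of_forall_pos_le_add fun ε hε => ?_
  set c := (∑ j, w j ^ 2) / 4 + (β t x + ε) with hc
  have hG := (hspace.sub htime).add ((hasDerivAt_id (0 : ℝ)).mul_const c)
  have hnonneg := hG.nonneg_of_eventually_nonneg_right (by simp) (by
    filter_upwards [eventually_integral_segment_le hS hβ (t := t) (x := x) ⟨ht, htT⟩ w hε,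
      Ioo_mem_nhdsGT ht] with h hint hh
    have hh0 : 0 < h := hh.1
    have hsT : ((t - h : ℝ) : EReal) < T :=
      lt_trans (EReal.coe_lt_coe_iff.2 (by linarith)) htT
    have hus := hupos (t - h) x (sub_pos.2 hh.2) hsT
    have huy := hupos t (x + h • w) ht htT
    have hle := Real.log_le_log hus
      (hHar (t - h) t x (x + h • w) (sub_pos.2 hh.2) (by linarith) htT)
    rw [Real.log_mul huy.ne' (Real.exp_pos _).ne', Real.log_exp] at hle
    have hsq : (∑ j, (x j - (x + h • w) j) ^ 2) / (4 * (t - (t - h)))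
        = h * ((∑ j, w j ^ 2) / 4) := by
      have : ∑ j, (x j - (x + h • w) j) ^ 2 = h ^ 2 * ∑ j, w j ^ 2 := by
        rw [Finset.mul_sum]
        refine Finset.sum_congr rfl fun j _ => ?_
        simp only [Pi.add_apply, Pi.smul_apply, smul_eq_mul]
        ring
      rw [this, sub_sub_cancel]
      field_simp
    rw [hsq, sub_sub_cancel] at hle
    have hmul := mul_le_mul_of_nonneg_left hint hh0.le
    simp only [Pi.add_apply, Pi.sub_apply, id_eq, hc]
    linarith)
  have hDval : D = -2 * (∑ j, pd (fun z => u t z) j x ^ 2) / u t x := by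
    rw [hD, fderiv_apply_eq_sum_pd hdx, Finset.mul_sum, Finset.sum_div]
    exact Finset.sum_congr rfl fun j _ => by simp only [hw]; ring
  have hwsq : ∑ j, w j ^ 2 = 4 * (∑ j, pd (fun z => u t z) j x ^ 2) / u t x ^ 2 := by
    rw [Finset.mul_sum, Finset.sum_div]
    exact Finset.sum_congr rfl fun j _ => by simp only [hw]; ring
  rw [hc, hDval, hwsq] at hnonneg
  ring_nf at hnonneg ⊢
  linarith
end

section
/- Let d ≥ 1 and κ_1,…,κ_d > 0. For every fixed t > 0 and y ∈ ℝ^d, the function x ↦ log( h_t(x,y) / h_t(x,0) ) is convex on ℝ^d, where h_t is the heat kernel of the Dunkl harmonic oscillator. -/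
open Real MeasureTheory

/-- The integral in `hKer`, as a function of the coefficient in the exponential. -/
noncomputable def hKerIntegral (κ c : ℝ) : ℝ :=
  ∫ s in (-1 : ℝ)..(1 : ℝ), (1 - s) ^ (κ - 1) * (1 + s) ^ κ * Real.exp (c * s)

theorem intervalIntegrable_hKerIntegrand {κ : ℝ} (hκ : 0 < κ) (c : ℝ) :
    IntervalIntegrable (fun s : ℝ => (1 - s) ^ (κ - 1) * (1 + s) ^ κ * Real.exp (c * s))
      volume (-1) 1 := by
  have h₁ : IntervalIntegrable (fun s : ℝ => (1 - s) ^ (κ - 1)) volume (-1) 1 := by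
    have h := (intervalIntegral.intervalIntegrable_rpow' (a := 2) (b := 0)
      (show -1 < κ - 1 by linarith)).comp_sub_left 1
    norm_num at h
    exact h
  have h₂ : Continuous fun s : ℝ => (1 + s) ^ κ * Real.exp (c * s) :=
    ((continuous_const.add continuous_id).rpow_const fun _ => Or.inr hκ.le).mul (by fun_prop)
  simpa only [mul_assoc] using h₁.mul_continuousOn h₂.continuousOn

theorem hKerIntegral_pos {κ : ℝ} (hκ : 0 < κ) (c : ℝ) : 0 < hKerIntegral κ c := by
  refine intervalIntegral.intervalIntegral_pos_of_pos_on
    (intervalIntegrable_hKerIntegrand hκ c) (fun s hs => ?_) (by norm_num)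
  have h₁ : 0 < 1 - s := by linarith [hs.2]
  have h₂ : 0 < 1 + s := by linarith [hs.1]
  positivity

theorem convexOn_log_hKerIntegral {κ : ℝ} (hκ : 0 < κ) :
    ConvexOn ℝ Set.univ fun c => Real.log (hKerIntegral κ c) := by
  refine ⟨convex_univ, fun x _ y _ a b ha hb hab => ?_⟩
  simp only [smul_eq_mul]
  have hx := hKerIntegral_pos hκ x
  have hy := hKerIntegral_pos hκ y
  set L := a * Real.log (hKerIntegral κ x) + b * Real.log (hKerIntegral κ y) with hL
  have hix := (intervalIntegrable_hKerIntegrand hκ x).const_mul (a / hKerIntegral κ x)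
  have hiy := (intervalIntegrable_hKerIntegrand hκ y).const_mul (b / hKerIntegral κ y)
  have key : Real.exp (-L) * hKerIntegral κ (a * x + b * y) ≤ 1 := by
    calc Real.exp (-L) * hKerIntegral κ (a * x + b * y)
        = ∫ s in (-1 : ℝ)..(1 : ℝ), Real.exp (-L) *
            ((1 - s) ^ (κ - 1) * (1 + s) ^ κ * Real.exp ((a * x + b * y) * s)) := by
          rw [intervalIntegral.integral_const_mul, hKerIntegral]
      _ ≤ ∫ s in (-1 : ℝ)..(1 : ℝ),
            (a / hKerIntegral κ x * ((1 - s) ^ (κ - 1) * (1 + s) ^ κ * Real.exp (x * s)) +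
            b / hKerIntegral κ y * ((1 - s) ^ (κ - 1) * (1 + s) ^ κ * Real.exp (y * s))) := by
          refine intervalIntegral.integral_mono_on (by norm_num)
            ((intervalIntegrable_hKerIntegrand hκ _).const_mul _) (hix.add hiy) fun s hs => ?_
          have hw : 0 ≤ (1 - s) ^ (κ - 1) * (1 + s) ^ κ :=
            mul_nonneg (Real.rpow_nonneg (by linarith [hs.2]) _)
              (Real.rpow_nonneg (by linarith [hs.1]) _)
          have hexp := convexOn_exp.2 (Set.mem_univ (x * s - Real.log (hKerIntegral κ x)))
            (Set.mem_univ (y * s - Real.log (hKerIntegral κ y))) ha hb hab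
          simp only [smul_eq_mul] at hexp
          rw [Real.exp_sub, Real.exp_sub, Real.exp_log hx, Real.exp_log hy] at hexp
          calc _ = (1 - s) ^ (κ - 1) * (1 + s) ^ κ *
                Real.exp (a * (x * s - Real.log (hKerIntegral κ x)) +
                  b * (y * s - Real.log (hKerIntegral κ y))) := by
                rw [mul_left_comm, ← Real.exp_add, hL]
                ring_nf
            _ ≤ _ := mul_le_mul_of_nonneg_left hexp hw
            _ = _ := by ring
      _ = a / hKerIntegral κ x * hKerIntegral κ x + b / hKerIntegral κ y * hKerIntegral κ y := by
          rw [intervalIntegral.integral_add hix hiy, intervalIntegral.integral_const_mul,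
            intervalIntegral.integral_const_mul]
          rfl
      _ = 1 := by rw [div_mul_cancel₀ _ hx.ne', div_mul_cancel₀ _ hy.ne', hab]
  rw [Real.log_le_iff_le_exp (hKerIntegral_pos hκ _)]
  rwa [Real.exp_neg, inv_mul_le_iff₀ (Real.exp_pos _), mul_one] at key

theorem hKer_eq (κ t u v : ℝ) :
    hKer κ t u v = ((2 : ℝ) ^ (κ + 1/2) * Real.sqrt π * Real.Gamma (κ + 1/2))⁻¹
      * Real.sinh (2*t) ^ (-(κ + 1/2))
      * Real.exp (-(1/2) * (Real.cosh (2*t) / Real.sinh (2*t)) * (u^2 + v^2))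
      * hKerIntegral κ (v / Real.sinh (2*t) * u) := by
  rw [hKer, hKerIntegral]
  congr! 5
  ring

theorem hKer_pos {κ t : ℝ} (hκ : 0 < κ) (ht : 0 < t) (u v : ℝ) : 0 < hKer κ t u v := by
  have hs : 0 < Real.sinh (2*t) := Real.sinh_pos_iff.2 (by linarith)
  have hΓ : 0 < Real.Gamma (κ + 1/2) := Real.Gamma_pos_of_pos (by linarith)
  have hI := hKerIntegral_pos hκ (v / Real.sinh (2*t) * u)
  rw [hKer_eq]
  positivity

theorem log_hKer_div {κ t : ℝ} (hκ : 0 < κ) (ht : 0 < t) (u v : ℝ) :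
    Real.log (hKer κ t u v / hKer κ t u 0) =
      Real.log (hKerIntegral κ (v / Real.sinh (2*t) * u)) +
        (-(1/2) * (Real.cosh (2*t) / Real.sinh (2*t)) * v^2 - Real.log (hKerIntegral κ 0)) := by
  have hs : 0 < Real.sinh (2*t) := Real.sinh_pos_iff.2 (by linarith)
  have hΓ : 0 < Real.Gamma (κ + 1/2) := Real.Gamma_pos_of_pos (by linarith)
  have hC : 0 < ((2 : ℝ) ^ (κ + 1/2) * Real.sqrt π * Real.Gamma (κ + 1/2))⁻¹
      * Real.sinh (2*t) ^ (-(κ + 1/2)) := by positivity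
  have hlog (w : ℝ) := Real.log_mul (mul_pos hC (Real.exp_pos
    (-(1/2) * (Real.cosh (2*t) / Real.sinh (2*t)) * (u^2 + w^2)))).ne'
    (hKerIntegral_pos hκ (w / Real.sinh (2*t) * u)).ne'
  rw [Real.log_div (hKer_pos hκ ht u v).ne' (hKer_pos hκ ht u 0).ne', hKer_eq, hKer_eq,
    hlog, hlog, Real.log_mul hC.ne' (Real.exp_pos _).ne', Real.log_mul hC.ne' (Real.exp_pos _).ne',
    Real.log_exp, Real.log_exp, zero_div, zero_mul]
  ring

theorem convexOn_log_hKer_div {κ t : ℝ} (hκ : 0 < κ) (ht : 0 < t) (v : ℝ) :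
    ConvexOn ℝ Set.univ fun u => Real.log (hKer κ t u v / hKer κ t u 0) := by
  simp only [log_hKer_div hκ ht]
  exact ((convexOn_log_hKerIntegral hκ).comp_linearMap
    (LinearMap.mulLeft ℝ (v / Real.sinh (2*t)))).add_const _

/-- For each `t > 0` and `y ∈ ℝ^d`, the function `x ↦ log(h_t(x,y)/h_t(x,0))` is convex
on `ℝ^d`, where `h_t` is the heat kernel of the Dunkl harmonic oscillator. -/
theorem stmt8 (d : ℕ) (hd : 1 ≤ d) (κ : Fin d → ℝ) (hκ : ∀ j, 0 < κ j)
    (t : ℝ) (ht : 0 < t) (y : Fin d → ℝ) :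
    ConvexOn ℝ Set.univ
      (fun x : Fin d → ℝ => Real.log (hHeat κ t x y / hHeat κ t x 0)) := by
  have hsum (x : Fin d → ℝ) : Real.log (hHeat κ t x y / hHeat κ t x 0) =
      ∑ j, Real.log (hKer (κ j) t (x j) (y j) / hKer (κ j) t (x j) 0) := by
    rw [hHeat, hHeat, ← Finset.prod_div_distrib, Real.log_prod fun j _ =>
      (div_pos (hKer_pos (hκ j) ht _ _) (hKer_pos (hκ j) ht _ _)).ne']
    rfl
  simp only [hsum]
  refine ⟨convex_univ, fun x _ z _ a b ha hb hab => ?_⟩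
  rw [Finset.smul_sum, Finset.smul_sum, ← Finset.sum_add_distrib]
  exact Finset.sum_le_sum fun j _ => (convexOn_log_hKer_div (hκ j) ht (y j)).2
    (Set.mem_univ (x j)) (Set.mem_univ (z j)) ha hb hab
end
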